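/- arXiv:1805.00692 — 3 statements merged into one kernel-verified Lean document; each statement's English description precedes it below -/
import Mathlib

section
/- Let a ∈ ℝ^d be a unit vector, let v ∈ ℝ^d, and let s, t be real numbers with 0 < t < s such that ‖v − s·a‖₂ ≤ t. Then v ≠ 0 and ‖v/‖v‖₂ − a‖₂ ≤ (t/s)·√(1 + t²/s²). -/
/-- A degree-two lower bound for the square root of `1 - y` on the unit interval. -/
theorem one_sub_half_add_sq_le_sqrt_one_sub {y : ℝ} (hy0 : 0 ≤ y) (hy1 : y ≤ 1) :
    1 - (y + y ^ 2) / 2 ≤ √(1 - y) := by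
  apply Real.le_sqrt_of_sq_le
  nlinarith [mul_nonneg (sq_nonneg y) (mul_nonneg (sub_nonneg.2 hy1) (by linarith : 0 ≤ 3 + y))]

/-- If `v` lies within `t ≤ s` of `s • a` for a unit vector `a`, then the cosine of the angle
between `v` and `a` is at least `√(1 - (t / s) ^ 2)`. -/
theorem norm_mul_sqrt_le_inner_of_norm_sub_smul_le {E : Type*} [NormedAddCommGroup E]
    [InnerProductSpace ℝ E] {a v : E} {s t : ℝ} (ha : ‖a‖ = 1) (ht : 0 ≤ t) (hs : 0 < s)
    (hts : t ≤ s) (h : ‖v - s • a‖ ≤ t) :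
    ‖v‖ * √(1 - (t / s) ^ 2) ≤ inner ℝ v a := by
  have hx1 : (t / s) ^ 2 ≤ 1 := pow_le_one₀ (by positivity) ((div_le_one hs).2 hts)
  have hw := Real.sq_sqrt (sub_nonneg.2 hx1)
  have hsq : ‖v - s • a‖ ^ 2 ≤ t ^ 2 := by gcongr
  rw [norm_sub_sq_real, real_inner_smul_right, norm_smul, ha, mul_one, Real.norm_eq_abs,
    sq_abs] at hsq
  have hsw : s ^ 2 * √(1 - (t / s) ^ 2) ^ 2 = s ^ 2 - t ^ 2 := by
    rw [hw]
    field_simp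
  refine le_of_mul_le_mul_left ?_ hs
  nlinarith [sq_nonneg (‖v‖ - s * √(1 - (t / s) ^ 2))]


/-- Let `a ∈ ℝ^d` be a unit vector, let `v ∈ ℝ^d`, and let `s, t` be real numbers with
`0 < t < s` such that `‖v − s·a‖₂ ≤ t`. Then `v ≠ 0` and
`‖v/‖v‖₂ − a‖₂ ≤ (t/s)·√(1 + t²/s²)`. -/
theorem stmt_4 (d : ℕ) (a v : EuclideanSpace ℝ (Fin d)) (s t : ℝ)
    (ha : ‖a‖ = 1) (ht : 0 < t) (hts : t < s) (h : ‖v - s • a‖ ≤ t) :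
    v ≠ 0 ∧ ‖‖v‖⁻¹ • v - a‖ ≤ (t / s) * Real.sqrt (1 + t ^ 2 / s ^ 2) := by
  have hs : 0 < s := ht.trans hts
  have hv : v ≠ 0 := by
    rintro rfl
    rw [zero_sub, norm_neg, norm_smul, ha, mul_one, Real.norm_eq_abs, abs_of_pos hs] at h
    exact absurd h hts.not_ge
  refine ⟨hv, ?_⟩
  have hn : 0 < ‖v‖ := norm_pos_iff.2 hv
  have hx1 : (t / s) ^ 2 ≤ 1 := pow_le_one₀ (by positivity) ((div_le_one hs).2 hts.le)
  have hroot := one_sub_half_add_sq_le_sqrt_one_sub (sq_nonneg (t / s)) hx1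
  have hinner : √(1 - (t / s) ^ 2) ≤ ‖v‖⁻¹ * inner ℝ v a := by
    rw [le_inv_mul_iff₀ hn]
    exact norm_mul_sqrt_le_inner_of_norm_sub_smul_le ha ht.le hs hts.le h
  refine (sq_le_sq₀ (norm_nonneg _) (by positivity)).1 ?_
  rw [mul_pow, Real.sq_sqrt (by positivity), ← div_pow, norm_sub_sq_real, real_inner_smul_left,
    norm_smul, norm_inv, norm_norm, inv_mul_cancel₀ hn.ne', ha]
  linarith
end

section
/- Let 1 ≤ S < K, 0 ≤ ε < √2 and 0 ≤ δ < 1, and let Γ : ℝ^d → ℝ^m be a linear map with (1−δ) ≤ ‖Γφ_k‖₂² ≤ (1+δ) for every k. With perturbed atoms ψ_k = α_k·φ_k + ω_k·z_k (α_k = 1 − ε_k²/2, ω_k = √(ε_k² − ε_k⁴/4), ε_k ∈ [0, ε]), signal y = (Σ_j σ(j)·c(p(j))·φ_j + r)/√(1+‖r‖₂²) and oracle support I° = p^{−1}({1,…,S}) as in the setup, assume that for every k ∈ {1,…,K}: |Σ_{j≠k} σ(j)·c(p(j))·⟨Γφ_k, Γφ_j⟩| + |⟨Γφ_k, Γr⟩|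 + ω_k·|Σ_j σ(j)·c(p(j))·⟨Γz_k, Γφ_j⟩| + ω_k·|⟨Γz_k, Γr⟩| < (1/2)·[c(S)·(1−δ)·(1−ε²/2) − c(S+1)·(1+δ)]. Then min_{k ∈ I°} |⟨Γψ_k, Γy⟩| > max_{k ∉ I°} |⟨Γψ_k, Γy⟩|; that is, compressed thresholding with support size S recovers the oracle support. -/
open scoped RealInnerProductSpace

/-- The correlation of an embedded perturbed atom `a • u + w • v` with an embedded signal deviates
from the contribution `a * (x k * ‖Γ (φ k)‖ ^ 2)` of the `k`-th coefficient by at most the embedded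
interference. -/
lemma abs_inner_map_sub_le {ι E F : Type*} [Fintype ι] [DecidableEq ι]
    [NormedAddCommGroup E] [InnerProductSpace ℝ E] [NormedAddCommGroup F] [InnerProductSpace ℝ F]
    (Γ : E →ₗ[ℝ] F) (φ : ι → E) (x : ι → ℝ) (r v : E) (k : ι) {a w : ℝ}
    (ha0 : 0 ≤ a) (ha1 : a ≤ 1) (hw : 0 ≤ w) :
    |⟪Γ (a • φ k + w • v), Γ ((∑ j, x j • φ j) + r)⟫ - a * (x k * ‖Γ (φ k)‖ ^ 2)|
      ≤ |∑ j ∈ Finset.univ.erase k, x j * ⟪Γ (φ k), Γ (φ j)⟫| + |⟪Γ (φ k), Γ r⟫|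
        + w * |∑ j, x j * ⟪Γ v, Γ (φ j)⟫| + w * |⟪Γ v, Γ r⟫| := by
  have hsplit := Finset.add_sum_erase Finset.univ
    (fun j => x j * ⟪Γ (φ k), Γ (φ j)⟫) (Finset.mem_univ k)
  simp only [real_inner_self_eq_norm_sq] at hsplit
  set A := ∑ j ∈ Finset.univ.erase k, x j * ⟪Γ (φ k), Γ (φ j)⟫
  have hexp : ⟪Γ (a • φ k + w • v), Γ ((∑ j, x j • φ j) + r)⟫ - a * (x k * ‖Γ (φ k)‖ ^ 2)
      = a * (A + ⟪Γ (φ k), Γ r⟫)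
        + w * (∑ j, x j * ⟪Γ v, Γ (φ j)⟫ + ⟪Γ v, Γ r⟫) := by
    simp only [map_add, map_smul, inner_add_left, real_inner_smul_left]
    simp only [map_sum, map_smul, inner_add_right, inner_sum, real_inner_smul_right]
    rw [← hsplit]
    ring
  rw [hexp]
  calc _ ≤ |a * (A + ⟪Γ (φ k), Γ r⟫)|
        + |w * (∑ j, x j * ⟪Γ v, Γ (φ j)⟫ + ⟪Γ v, Γ r⟫)| := abs_add_le _ _
    _ = a * |A + ⟪Γ (φ k), Γ r⟫|
        + w * |∑ j, x j * ⟪Γ v, Γ (φ j)⟫ + ⟪Γ v, Γ r⟫| := by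
      rw [abs_mul, abs_mul, abs_of_nonneg ha0, abs_of_nonneg hw]
    _ ≤ 1 * (|A| + |⟪Γ (φ k), Γ r⟫|)
        + w * (|∑ j, x j * ⟪Γ v, Γ (φ j)⟫| + |⟪Γ v, Γ r⟫|) := by
      gcongr <;> exact abs_add_le _ _
    _ = _ := by ring

/-- Compressed thresholding recovers the oracle support: with perturbed atoms
`ψ_k = α_k·φ_k + ω_k·z_k`, signal `y = (Σ_j σ(j)·c(p(j))·φ_j + r)/√(1+‖r‖₂²)` and
oracle support `I° = p⁻¹({1,…,S})`, if the embedded interference of every atom is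
smaller than half the embedded coefficient gap, then
`min_{k ∈ I°} |⟨Γψ_k, Γy⟩| > max_{k ∉ I°} |⟨Γψ_k, Γy⟩|`.
(Indices are zero-based: the rank of atom `k` is `p k`, the oracle support is
`{k | (p k : ℕ) < S}`, the `S`-th largest coefficient `c(S)` is `c ⟨S-1,_⟩` and
`c(S+1)` is `c ⟨S,_⟩`.) -/
theorem stmt_13 (d m K S : ℕ) (hS : 1 ≤ S) (hSK : S < K)
    (ε δ : ℝ) (hε0 : 0 ≤ ε) (hε2 : ε < Real.sqrt 2) (hδ0 : 0 ≤ δ) (hδ1 : δ < 1)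
    (φ z : Fin K → EuclideanSpace ℝ (Fin d))
    (hφ : ∀ k, ‖φ k‖ = 1) (hz : ∀ k, ‖z k‖ = 1) (hφz : ∀ k, ⟪φ k, z k⟫ = 0)
    (εk : Fin K → ℝ) (hεk : ∀ k, 0 ≤ εk k ∧ εk k ≤ ε)
    (α ω : Fin K → ℝ)
    (hα : ∀ k, α k = 1 - εk k ^ 2 / 2)
    (hω : ∀ k, ω k = Real.sqrt (εk k ^ 2 - εk k ^ 4 / 4))
    (ψ : Fin K → EuclideanSpace ℝ (Fin d))
    (hψ : ∀ k, ψ k = α k • φ k + ω k • z k)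
    (c : Fin K → ℝ) (hc : Antitone c) (hcnonneg : ∀ k, 0 ≤ c k)
    (p : Equiv.Perm (Fin K)) (σ : Fin K → ℝ) (hσ : ∀ j, σ j = 1 ∨ σ j = -1)
    (r y : EuclideanSpace ℝ (Fin d))
    (hy : y = (Real.sqrt (1 + ‖r‖ ^ 2))⁻¹ • ((∑ j, (σ j * c (p j)) • φ j) + r))
    (Γ : EuclideanSpace ℝ (Fin d) →ₗ[ℝ] EuclideanSpace ℝ (Fin m))
    (hΓ : ∀ k, 1 - δ ≤ ‖Γ (φ k)‖ ^ 2 ∧ ‖Γ (φ k)‖ ^ 2 ≤ 1 + δ)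
    (hmain : ∀ k : Fin K,
      |∑ j ∈ Finset.univ.erase k, σ j * c (p j) * ⟪Γ (φ k), Γ (φ j)⟫|
        + |⟪Γ (φ k), Γ r⟫|
        + ω k * |∑ j, σ j * c (p j) * ⟪Γ (z k), Γ (φ j)⟫|
        + ω k * |⟪Γ (z k), Γ r⟫|
      < (1 / 2) * (c ⟨S - 1, by omega⟩ * (1 - δ) * (1 - ε ^ 2 / 2)
          - c ⟨S, hSK⟩ * (1 + δ))) :
    ∀ k : Fin K, (p k : ℕ) < S →
      ∀ j : Fin K, ¬ ((p j : ℕ) < S) →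
        |⟪Γ (ψ j), Γ y⟫| < |⟪Γ (ψ k), Γ y⟫| := by
  intro k hk j hj
  have hε : ε ^ 2 < 2 := by
    have := (Real.lt_sqrt hε0).1 hε2
    exact this
  have hαlow : ∀ i, 1 - ε ^ 2 / 2 ≤ α i := fun i => by
    have : εk i ^ 2 ≤ ε ^ 2 := pow_le_pow_left₀ (hεk i).1 (hεk i).2 2
    rw [hα]
    linarith
  have hα0 : ∀ i, 0 ≤ α i := fun i => by linarith [hαlow i]
  have hα1 : ∀ i, α i ≤ 1 := fun i => by rw [hα]; linarith [sq_nonneg (εk i)]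
  have hω0 : ∀ i, 0 ≤ ω i := fun i => by rw [hω]; exact Real.sqrt_nonneg _
  have habs : ∀ i, |α i * (σ i * c (p i) * ‖Γ (φ i)‖ ^ 2)|
      = α i * (c (p i) * ‖Γ (φ i)‖ ^ 2) := fun i => by
    have hσi : |σ i| = 1 := by rcases hσ i with h | h <;> simp [h]
    rw [abs_mul, abs_mul, abs_mul, hσi, abs_of_nonneg (hα0 i), abs_of_nonneg (hcnonneg _),
      abs_of_nonneg (sq_nonneg _), one_mul]
  have hdev := fun i => (abs_inner_map_sub_le Γ φ (fun j => σ j * c (p j)) r (z i) i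
    (hα0 i) (hα1 i) (hω0 i)).trans_lt (hmain i)
  have hck : c ⟨S - 1, by omega⟩ ≤ c (p k) := hc (Fin.mk_le_mk.2 (by omega : (p k : ℕ) ≤ S - 1))
  have hcj : c (p j) ≤ c ⟨S, hSK⟩ := hc (Fin.mk_le_mk.2 (not_lt.1 hj))
  have hlow : c ⟨S - 1, by omega⟩ * (1 - δ) * (1 - ε ^ 2 / 2)
      ≤ α k * (c (p k) * ‖Γ (φ k)‖ ^ 2) := by
    rw [mul_comm]
    exact mul_le_mul (hαlow k)
      (mul_le_mul hck (hΓ k).1 (by linarith) (hcnonneg _))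
      (mul_nonneg (hcnonneg _) (by linarith)) (hα0 k)
  have hupp : α j * (c (p j) * ‖Γ (φ j)‖ ^ 2) ≤ c ⟨S, hSK⟩ * (1 + δ) :=
    (mul_le_of_le_one_left (mul_nonneg (hcnonneg _) (sq_nonneg _)) (hα1 j)).trans
      (mul_le_mul hcj (hΓ j).2 (sq_nonneg _) (hcnonneg _))
  have hinv : 0 < (Real.sqrt (1 + ‖r‖ ^ 2))⁻¹ := by positivity
  rw [hy, map_smul, real_inner_smul_right, real_inner_smul_right, abs_mul, abs_mul,
    abs_of_pos hinv, hψ, hψ]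
  refine mul_lt_mul_of_pos_left ?_ hinv
  have hdj := (abs_sub_abs_le_abs_sub _ _).trans_lt (hdev j)
  have hdk := (abs_sub_abs_le_abs_sub _ _).trans_lt ((abs_sub_comm _ _).trans_lt (hdev k))
  rw [habs] at hdj hdk
  linarith
end

section
/- Let 1 ≤ S ≤ K and 0 ≤ ε < √2 (so that α_k = 1 − ε_k²/2 > 0 for ε_k ∈ [0, ε]). With perturbed atoms ψ_k = α_k·φ_k + ω_k·z_k, signal y = (Σ_j σ(j)·c(p(j))·φ_j + r)/√(1+‖r‖₂²) and oracle support I° = p^{−1}({1,…,S}) as in the setup, assume that for every k ∈ I°: |Σ_{j≠k} σ(j)·c(p(j))·⟨φ_k, φ_j⟩| + |⟨φ_k, r⟩| + (ω_k/α_k)·|Σ_j σ(j)·c(p(j))·⟨z_k, φ_j⟩| + (ω_k/α_k)·|⟨z_k, r⟩| < c(S). Then for every k ∈ I° one has ⟨ψ_k, y⟩ ≠ 0 and sign(⟨ψ_k, y⟩) = σ(k); that is, the oracle signs are recovered from the unembedded inner products. -/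
open scoped RealInnerProductSpace

/-- A scalar `s * m` with `s = ±1`, perturbed by less than `m` in absolute value and multiplied by
a positive factor, is nonzero and has sign `s`. -/
theorem sign_pos_mul_add_of_abs_lt {a s m e : ℝ} (ha : 0 < a) (hs : s = 1 ∨ s = -1)
    (he : |e| < m) : a * (s * m + e) ≠ 0 ∧ Real.sign (a * (s * m + e)) = s := by
  obtain ⟨h₁, h₂⟩ := abs_lt.mp he
  rcases hs with rfl | rfl
  · have h : 0 < a * (1 * m + e) := mul_pos ha (by linarith)
    exact ⟨h.ne', Real.sign_of_pos h⟩
  · have h : a * (-1 * m + e) < 0 := mul_neg_of_pos_of_neg ha (by linarith)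
    exact ⟨h.ne, Real.sign_of_neg h⟩

/-- The inner product of a unit atom with a linear combination of atoms, split into its own
coefficient and the interference of the other atoms. -/
theorem inner_sum_smul_eq_add_sum_erase {ι E : Type*} [Fintype ι] [DecidableEq ι]
    [NormedAddCommGroup E] [InnerProductSpace ℝ E] (φ : ι → E) (x : ι → ℝ) {k : ι}
    (hk : ‖φ k‖ = 1) :
    ⟪φ k, ∑ j, x j • φ j⟫ = x k + ∑ j ∈ Finset.univ.erase k, x j * ⟪φ k, φ j⟫ := by
  simp only [inner_sum, real_inner_smul_right]
  rw [← Finset.add_sum_erase _ _ (Finset.mem_univ k), real_inner_self_eq_norm_sq, hk]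
  simp

/-- Oracle sign recovery: with perturbed atoms `ψ_k = α_k·φ_k + ω_k·z_k`, signal
`y = (Σ_j σ(j)·c(p(j))·φ_j + r)/√(1+‖r‖₂²)` and oracle support `I° = p⁻¹({1,…,S})`,
if for every `k ∈ I°` the interference is smaller than `c(S)`, then for every `k ∈ I°`
one has `⟨ψ_k, y⟩ ≠ 0` and `sign(⟨ψ_k, y⟩) = σ(k)`.
(Indices are zero-based: the rank of atom `k` is `p k`, the oracle support is
`{k | (p k : ℕ) < S}`, and the `S`-th largest coefficient `c(S)` is `c ⟨S-1,_⟩`.) -/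
theorem stmt_14 (d K S : ℕ) (hS : 1 ≤ S) (hSK : S ≤ K)
    (ε : ℝ) (hε0 : 0 ≤ ε) (hε2 : ε < Real.sqrt 2)
    (φ z : Fin K → EuclideanSpace ℝ (Fin d))
    (hφ : ∀ k, ‖φ k‖ = 1) (hz : ∀ k, ‖z k‖ = 1) (hφz : ∀ k, ⟪φ k, z k⟫ = 0)
    (εk : Fin K → ℝ) (hεk : ∀ k, 0 ≤ εk k ∧ εk k ≤ ε)
    (α ω : Fin K → ℝ)
    (hα : ∀ k, α k = 1 - εk k ^ 2 / 2)
    (hω : ∀ k, ω k = Real.sqrt (εk k ^ 2 - εk k ^ 4 / 4))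
    (ψ : Fin K → EuclideanSpace ℝ (Fin d))
    (hψ : ∀ k, ψ k = α k • φ k + ω k • z k)
    (c : Fin K → ℝ) (hc : Antitone c) (hcnonneg : ∀ k, 0 ≤ c k)
    (p : Equiv.Perm (Fin K)) (σ : Fin K → ℝ) (hσ : ∀ j, σ j = 1 ∨ σ j = -1)
    (r y : EuclideanSpace ℝ (Fin d))
    (hy : y = (Real.sqrt (1 + ‖r‖ ^ 2))⁻¹ • ((∑ j, (σ j * c (p j)) • φ j) + r))
    (hmain : ∀ k : Fin K, (p k : ℕ) < S →
      |∑ j ∈ Finset.univ.erase k, σ j * c (p j) * ⟪φ k, φ j⟫|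
        + |⟪φ k, r⟫|
        + (ω k / α k) * |∑ j, σ j * c (p j) * ⟪z k, φ j⟫|
        + (ω k / α k) * |⟪z k, r⟫|
      < c ⟨S - 1, by omega⟩) :
    ∀ k : Fin K, (p k : ℕ) < S →
      ⟪ψ k, y⟫ ≠ 0 ∧ Real.sign ⟪ψ k, y⟫ = σ k := by
  intro k hk
  have hαpos : 0 < α k := by
    have h : εk k ^ 2 < 2 :=
      (Real.lt_sqrt (hεk k).1).mp ((hεk k).2.trans_lt hε2)
    rw [hα]
    linarith
  have ht : 0 ≤ ω k / α k := div_nonneg (by rw [hω]; exact Real.sqrt_nonneg _) hαpos.le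
  have hck : c ⟨S - 1, by omega⟩ ≤ c (p k) := hc (Fin.le_def.mpr (by simp only; omega))
  have hlt := (hmain k hk).trans_le hck
  have hscale : 0 < (Real.sqrt (1 + ‖r‖ ^ 2))⁻¹ * α k :=
    mul_pos (inv_pos.mpr (Real.sqrt_pos.mpr (by positivity))) hαpos
  have hzsum : ⟪z k, ∑ j, (σ j * c (p j)) • φ j⟫ = ∑ j, σ j * c (p j) * ⟪z k, φ j⟫ := by
    simp only [inner_sum, real_inner_smul_right]
  have hinner : ⟪ψ k, y⟫ = ((Real.sqrt (1 + ‖r‖ ^ 2))⁻¹ * α k) * (σ k * c (p k) +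
      (∑ j ∈ Finset.univ.erase k, σ j * c (p j) * ⟪φ k, φ j⟫ + ⟪φ k, r⟫
        + (ω k / α k) * ∑ j, σ j * c (p j) * ⟪z k, φ j⟫ + (ω k / α k) * ⟪z k, r⟫)) := by
    rw [hψ, hy, real_inner_smul_right, inner_add_left, real_inner_smul_left,
      real_inner_smul_left, inner_add_right, inner_add_right, hzsum,
      inner_sum_smul_eq_add_sum_erase φ (fun j => σ j * c (p j)) (hφ k)]
    field_simp
    ring
  rw [hinner]
  refine sign_pos_mul_add_of_abs_lt hscale (hσ k) (lt_of_le_of_lt ?_ hlt)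
  rw [← abs_of_nonneg ht, ← abs_mul, ← abs_mul, abs_of_nonneg ht]
  refine (abs_add_le _ _).trans (add_le_add_left ?_ _)
  exact (abs_add_le _ _).trans (add_le_add_left (abs_add_le _ _) _)
end
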